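/- arXiv:2111.11194 — 2 statements merged into one kernel-verified Lean document; each statement's English description precedes it below -/
import Mathlib

section
/- Let f : Σ' → Σ be a proper map between non-compact surfaces, let {Σₙ'} be a pairwise disjoint collection of compact bordered subsurfaces of Σ', and for each n let Hₙ : Σₙ' × [0,1] → Σ be a homotopy relative to ∂Σₙ' with Hₙ(−,0) = f restricted to Σₙ', such that the collection of images {im(Hₙ)} is locally finite in Σ (every compact subset of Σ meets only finitely many im(Hₙ)). Then the map H : Σ' × [0,1] → Σ defined by H(p,t) = Hₙ(p,t) for p ∈ Σₙ' and H(p,t) = f(p) for p outside all Σₙ' is a proper map. -/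
/-- A surface: a connected 2-manifold without boundary (Hausdorff, second countable,
connected, locally homeomorphic to the plane). -/
def IsSurface (X : Type*) [TopologicalSpace X] : Prop :=
  T2Space X ∧ SecondCountableTopology X ∧ ConnectedSpace X ∧
    ∀ x : X, ∃ U : Set X, IsOpen U ∧ x ∈ U ∧ Nonempty (U ≃ₜ (ℝ × ℝ))

/-- `A` is a bordered subsurface of `X`: it is connected and every point has a
neighborhood (in `A`) homeomorphic to the plane or to the closed half-plane. -/
def IsBorderedSubsurface {X : Type*} [TopologicalSpace X] (A : Set X) : Prop :=
  IsConnected A ∧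
    ∀ x : A, ∃ U : Set A, IsOpen U ∧ x ∈ U ∧
      (Nonempty (U ≃ₜ (ℝ × ℝ)) ∨ Nonempty (U ≃ₜ {p : ℝ × ℝ | 0 ≤ p.2}))

/-- The (manifold) boundary of a subsurface `A ⊆ X`: the points of `A` having no
neighborhood in `A` homeomorphic to the plane. -/
def subsurfaceBoundary {X : Type*} [TopologicalSpace X] (A : Set X) : Set X :=
  {x | ∃ h : x ∈ A, ¬ ∃ U : Set A, IsOpen U ∧ ⟨x, h⟩ ∈ U ∧ Nonempty (U ≃ₜ (ℝ × ℝ))}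

section Aux
open Set Metric Topology

lemma no_retract (h : ℂ → ℂ) (hc : Continuous h) (h0 : ∀ x, ‖x‖ ≤ 1 → h x ≠ 0)
    (h1 : ∀ x, ‖x‖ = 1 → ‖h x - x‖ < 1) : False := by
  let ρ : ℂ → ℂ := fun x => x / ((max 1 ‖x‖ : ℝ) : ℂ)
  have hpos : ∀ x : ℂ, 0 < max 1 ‖x‖ := fun x => lt_max_of_lt_left one_pos
  have hρc : Continuous ρ := by
    refine continuous_id.div (by fun_prop) fun x => ?_
    exact_mod_cast (hpos x).ne'
  have hρn : ∀ x, ‖ρ x‖ ≤ 1 := by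
    intro x
    simp only [ρ, norm_div, Complex.norm_real, Real.norm_eq_abs, abs_of_pos (hpos x)]
    rw [div_le_one (hpos x)]; exact le_max_right _ _
  have hρ1 : ∀ x : ℂ, ‖x‖ = 1 → ρ x = x := by intro x hx; simp [ρ, hx]
  obtain ⟨u, ⟨-, hu⟩, -⟩ := Complex.isCoveringMapOn_exp.existsUnique_continuousMap_lifts
    (⟨h ∘ ρ, hc.comp hρc⟩ : C(ℂ, ℂ)) (a₀ := 0) (e₀ := Complex.log (h (ρ 0)))
    (Complex.exp_log (h0 _ (hρn 0))) (fun a => h0 _ (hρn a))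
  let e : ℝ → ℂ := fun θ => Complex.exp (θ * Complex.I)
  have hec : Continuous e := by fun_prop
  have hen : ∀ θ, ‖e θ‖ = 1 := fun θ => Complex.norm_exp_ofReal_mul_I θ
  have he0 : ∀ θ, e θ ≠ 0 := fun θ => Complex.exp_ne_zero _
  have hq : ∀ θ, h (e θ) / e θ ∈ Complex.slitPlane := by
    intro θ
    have h4 : h (e θ) / e θ = 1 + (h (e θ) - e θ) / e θ := by
      field_simp [he0 θ]
      ring
    rw [h4]
    apply Complex.mem_slitPlane_of_norm_lt_one
    rw [norm_div, hen, div_one]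
    exact h1 _ (hen θ)
  let w : ℝ → ℂ := fun θ => u (e θ) - Complex.log (h (e θ) / e θ) - θ * Complex.I
  have hwc : Continuous w := by
    refine ((u.continuous.comp hec).sub (Continuous.clog ((hc.comp hec).div hec he0) hq)).sub
      (by fun_prop)
  have hw : ∀ θ, Complex.exp (w θ) = 1 := by
    intro θ
    have h2 : Complex.exp (u (e θ)) = h (e θ) := by
      have := congrFun hu (e θ)
      simpa [hρ1 _ (hen θ)] using this
    have h3 : h (e θ) ≠ 0 := h0 _ (hen θ).le
    simp only [w]
    rw [Complex.exp_sub, Complex.exp_sub, h2, Complex.exp_log (div_ne_zero h3 (he0 θ))]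
    change h (e θ) / (h (e θ) / e θ) / e θ = 1
    field_simp [he0 θ]
  have hconst : w = fun _ => w 0 := by
    refine Complex.isCoveringMap_exp.eq_of_comp_eq hwc continuous_const ?_ 0 rfl
    funext θ; apply Subtype.ext; simp [hw]
  have := congrFun hconst (2 * Real.pi)
  have e1 : e (2 * Real.pi) = e 0 := by simp [e, Complex.exp_two_pi_mul_I]
  simp [w, e1] at this

lemma inv_domain (f : ℂ → ℂ) (hf : Continuous f) (hi : Function.Injective f) :
    range f ∈ 𝓝 (f 0) := by
  by_contra hno
  have hD : IsCompact (closedBall (0 : ℂ) 1) := isCompact_closedBall _ _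
  have : CompactSpace (closedBall (0 : ℂ) 1) := isCompact_iff_compactSpace.1 hD
  have hemb : IsClosedEmbedding (fun x : closedBall (0 : ℂ) 1 => f x) :=
    (hf.comp continuous_subtype_val).isClosedEmbedding (hi.comp Subtype.val_injective)
  obtain ⟨G, hG⟩ := ContinuousMap.exists_extension' hemb
    (⟨Subtype.val, continuous_subtype_val⟩ : C(closedBall (0 : ℂ) 1, ℂ))
  have hGf : ∀ x : ℂ, ‖x‖ ≤ 1 → G (f x) = x := fun x hx =>
    congrFun hG ⟨x, by simpa using hx⟩
  -- distance to the image of the sphere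
  obtain ⟨r, hr, hrs⟩ : ∃ r > 0, ∀ x : ℂ, ‖x‖ = 1 → r ≤ dist (f x) (f 0) := by
    have hK : IsCompact (sphere (0 : ℂ) 1) := isCompact_sphere _ _
    have hne : (sphere (0 : ℂ) 1).Nonempty := ⟨1, by simp⟩
    obtain ⟨x, hx, hmin⟩ := hK.exists_isMinOn hne
      (f := fun x => dist (f x) (f 0)) (by fun_prop)
    refine ⟨dist (f x) (f 0), dist_pos.2 fun h => ?_, fun y hy => hmin (by simpa using hy)⟩
    have := hi h; subst this; simp at hx
  obtain ⟨c, hc, hcr⟩ : ∃ c, dist c (f 0) < r / 2 ∧ c ∉ range f := by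
    by_contra hcon
    push Not at hcon
    exact hno (Filter.mem_of_superset (ball_mem_nhds _ (half_pos hr)) fun y hy => hcon y hy)
  set ε := r / 2 with hε
  have hεp : 0 < ε := half_pos hr
  obtain ⟨δ, hδ, hδf⟩ : ∃ δ > 0, ∀ x : ℂ, ‖x‖ < δ → dist (f x) c < ε := by
    have : {x | dist (f x) c < ε} ∈ 𝓝 (0 : ℂ) :=
      (isOpen_lt (by fun_prop) continuous_const).mem_nhds (by simpa [dist_comm] using hc)
    obtain ⟨δ, hδ, hs⟩ := Metric.mem_nhds_iff.1 this
    exact ⟨δ, hδ, fun x hx => hs (by simpa using hx)⟩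
  set η := min δ 1 / 2 with hη
  have hηp : 0 < η := half_pos (lt_min hδ one_pos)
  have hη1 : 2 * η ≤ 1 := by rw [hη]; linarith [min_le_right δ 1]
  have hη2 : 2 * η ≤ δ := by rw [hη]; linarith [min_le_left δ 1]
  obtain ⟨P, hP, hPG, -⟩ := G.continuous.exists_contDiff_approx 1 (continuous_const (y := η))
    (fun _ => hηp)
  have hnull : MeasureTheory.volume (P '' sphere c ε) = 0 :=
    MeasureTheory.addHaar_image_eq_zero_of_differentiableOn_of_addHaar_eq_zero _
      (hP.differentiable (by simp)).differentiableOn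
      (MeasureTheory.Measure.addHaar_sphere _ _ _)
  obtain ⟨v, hv, hvn⟩ : ∃ v ∈ ball (0 : ℂ) η, v ∉ P '' sphere c ε := by
    by_contra hcon
    push Not at hcon
    exact (measure_ball_pos MeasureTheory.volume (0 : ℂ) hηp).ne'
      (MeasureTheory.measure_mono_null hcon hnull)
  let Q : ℂ → ℂ := fun y => P y - v
  have hQc : Continuous Q := hP.continuous.sub continuous_const
  have hQG : ∀ y, ‖Q y - G y‖ < 2 * η := by
    intro y
    have h1 := hPG y
    rw [dist_eq_norm] at h1
    have h2 : ‖v‖ < η := by simpa using hv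
    calc ‖Q y - G y‖ = ‖(P y - G y) - v‖ := by simp only [Q]; ring_nf
      _ ≤ ‖P y - G y‖ + ‖v‖ := norm_sub_le _ _
      _ < 2 * η := by linarith
  have hne : ∀ x, f x - c ≠ 0 := fun x h => hcr ⟨x, sub_eq_zero.1 h⟩
  let Φ : ℂ → ℂ := fun x => c + ((max (ε / ‖f x - c‖) 1 : ℝ) : ℂ) * (f x - c)
  have hΦc : Continuous Φ := by
    have : Continuous fun x => ε / ‖f x - c‖ :=
      continuous_const.div (by fun_prop) fun x => (norm_pos_iff.2 (hne x)).ne'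
    fun_prop
  have hΦ1 : ∀ x, ε ≤ ‖f x - c‖ → Φ x = f x := by
    intro x hx
    have : ε / ‖f x - c‖ ≤ 1 := (div_le_one (norm_pos_iff.2 (hne x))).2 hx
    simp [Φ, max_eq_right this]
  have hΦ2 : ∀ x, ‖f x - c‖ < ε → Φ x ∈ sphere c ε := by
    intro x hx
    have hp := norm_pos_iff.2 (hne x)
    have : 1 ≤ ε / ‖f x - c‖ := (one_le_div hp).2 hx.le
    simp only [Φ, max_eq_left this, mem_sphere, dist_eq_norm, add_sub_cancel_left, norm_mul,
      Complex.norm_real, Real.norm_eq_abs, abs_of_pos (div_pos hεp hp)]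
    field_simp
  refine no_retract (fun x => Q (Φ x)) (hQc.comp hΦc) ?_ ?_
  · intro x hx h0
    rcases lt_or_ge ‖f x - c‖ ε with h | h
    · exact hvn ⟨Φ x, hΦ2 x h, sub_eq_zero.1 h0⟩
    · rw [hΦ1 x h] at h0
      have h3 := hQG (f x)
      rw [h0, hGf x hx, zero_sub, norm_neg] at h3
      have h4 := hδf x (h3.trans_le hη2)
      rw [dist_eq_norm] at h4
      linarith
  · intro x hx
    have h : ε ≤ ‖f x - c‖ := by
      have h1 := hrs x hx
      have h2 := dist_triangle (f x) c (f 0)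
      rw [← dist_eq_norm]
      linarith
    simp only [hΦ1 x h]
    have h3 := hQG (f x)
    rw [hGf x hx.le] at h3
    linarith

lemma inv_domain_manifold {M : Type*} [TopologicalSpace M] (g : ℂ → M) (hg : Continuous g)
    (hi : Function.Injective g) (z : ℂ) (V : Set M) (hV : IsOpen V) (hz : g z ∈ V)
    (φ : V ≃ₜ ℂ) : range g ∈ 𝓝 (g z) := by
  obtain ⟨r, hr, hs⟩ := Metric.mem_nhds_iff.1 ((hV.preimage hg).mem_nhds hz)
  let b := OpenPartialHomeomorph.univBall z r
  have hbc : Continuous b := OpenPartialHomeomorph.continuous_univBall z r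
  have hbi : Function.Injective b := by
    have := b.injOn
    rwa [OpenPartialHomeomorph.univBall_source, injOn_univ] at this
  have hb0 : b 0 = z := OpenPartialHomeomorph.univBall_apply_zero z r
  have hbV : ∀ x, g (b x) ∈ V := fun x => hs (by
    have := b.map_source (x := x) (by simp [b])
    rwa [OpenPartialHomeomorph.univBall_target z hr] at this)
  let F : ℂ → ℂ := fun x => φ ⟨g (b x), hbV x⟩
  have hFc : Continuous F := φ.continuous.comp ((hg.comp hbc).subtype_mk _)
  have hFi : Function.Injective F := fun x y h =>
    hbi (hi (congrArg Subtype.val (φ.injective h)))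
  have h1 := inv_domain F hFc hFi
  have ho : IsOpenMap fun y => (φ.symm y : M) := hV.isOpenMap_subtype_val.comp φ.symm.isOpenMap
  have h2 := ho.image_mem_nhds h1
  have h3 : (φ.symm (F 0) : M) = g z := by simp [F, hb0]
  rw [h3] at h2
  refine Filter.mem_of_superset h2 ?_
  rintro _ ⟨_, ⟨x, rfl⟩, rfl⟩
  exact ⟨b x, by simp [F]⟩

lemma not_boundary_interior {M : Type*} [TopologicalSpace M] (hM : IsSurface M) (A : Set M)
    (p : M) (hp : p ∈ A) (hb : p ∉ subsurfaceBoundary A) : p ∈ interior A := by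
  have hex : ∃ U : Set A, IsOpen U ∧ ⟨p, hp⟩ ∈ U ∧ Nonempty (U ≃ₜ (ℝ × ℝ)) := by
    by_contra h
    exact hb ⟨hp, h⟩
  obtain ⟨U, -, hpU, ⟨e⟩⟩ := hex
  obtain ⟨V, hV, hpV, ⟨φ⟩⟩ := hM.2.2.2 p
  let k : ℂ ≃ₜ ℝ × ℝ := Complex.equivRealProdCLM.toHomeomorph
  let g : ℂ → M := fun x => ((e.symm (k x) : U) : A)
  have hg : Continuous g := continuous_subtype_val.comp
    (continuous_subtype_val.comp (e.symm.continuous.comp k.continuous))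
  have hi : Function.Injective g := Subtype.val_injective.comp
    (Subtype.val_injective.comp (e.symm.injective.comp k.injective))
  have hz : g (k.symm (e ⟨⟨p, hp⟩, hpU⟩)) = p := by simp [g]
  have h := inv_domain_manifold g hg hi (k.symm (e ⟨⟨p, hp⟩, hpU⟩)) V hV (by rwa [hz])
    (φ.trans k.symm)
  rw [hz] at h
  refine mem_interior_iff_mem_nhds.2 (Filter.mem_of_superset h ?_)
  rintro _ ⟨x, rfl⟩
  exact Subtype.property _

lemma IsSurface.locallyCompact {M : Type*} [TopologicalSpace M] (hM : IsSurface M) :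
    WeaklyLocallyCompactSpace M := by
  refine ⟨fun x => ?_⟩
  obtain ⟨V, hV, hxV, ⟨φ⟩⟩ := hM.2.2.2 x
  obtain ⟨K, hK, hKx⟩ := exists_compact_mem_nhds (φ ⟨x, hxV⟩)
  refine ⟨(fun y => (φ.symm y : M)) '' K,
    hK.image (continuous_subtype_val.comp φ.symm.continuous), ?_⟩
  have ho : IsOpenMap fun y => (φ.symm y : M) := hV.isOpenMap_subtype_val.comp φ.symm.isOpenMap
  have := ho.image_mem_nhds hKx
  simpa using this

end Aux

/-- Pasting infinitely many boundary-relative homotopies with images going to infinity: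
if `f : M → N` is a proper map between non-compact surfaces, `{Sₙ}` a pairwise disjoint
collection of compact bordered subsurfaces of `M`, and `Hₙ : Sₙ × [0,1] → N` homotopies
relative to `∂Sₙ` starting at `f` with locally finite images, then the glued homotopy
(`Hₙ` on each `Sₙ`, stationary at `f` elsewhere) is a proper map. -/
theorem glued_homotopy_isProperMap
    {M N : Type*} [TopologicalSpace M] [TopologicalSpace N]
    (hM : IsSurface M) (hMnc : ¬ CompactSpace M)
    (hN : IsSurface N) (hNnc : ¬ CompactSpace N)
    (f : M → N) (hf : IsProperMap f)
    (S : ℕ → Set M)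
    (hScpt : ∀ n, IsCompact (S n))
    (hSsub : ∀ n, IsBorderedSubsurface (S n))
    (hSdisj : ∀ n m, n ≠ m → Disjoint (S n) (S m))
    (Hfam : (n : ℕ) → (S n) × unitInterval → N)
    (hHcont : ∀ n, Continuous (Hfam n))
    (hH0 : ∀ n (p : M) (hp : p ∈ S n), Hfam n (⟨p, hp⟩, 0) = f p)
    (hHrel : ∀ n (p : M) (hp : p ∈ S n), p ∈ subsurfaceBoundary (S n) →
      ∀ t, Hfam n (⟨p, hp⟩, t) = f p)
    (hHlf : ∀ K : Set N, IsCompact K → {n : ℕ | (Set.range (Hfam n) ∩ K).Nonempty}.Finite)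
    (H : M × unitInterval → N)
    (hHin : ∀ n (p : M) (hp : p ∈ S n) (t : unitInterval), H (p, t) = Hfam n (⟨p, hp⟩, t))
    (hHout : ∀ p : M, (∀ n, p ∉ S n) → ∀ t, H (p, t) = f p) :
    IsProperMap H := by
  have hM2 : T2Space M := hM.1
  have hN2 : T2Space N := hN.1
  have hMl := hM.locallyCompact
  have hNl := hN.locallyCompact
  -- continuity
  have hcont : Continuous H := by
    let C : Option ℕ → Set (M × unitInterval) := fun o =>
      o.elim (Prod.fst ⁻¹' (⋃ n, interior (S n))ᶜ) (fun n => Prod.fst ⁻¹' S n)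
    have hlf : LocallyFinite C := by
      intro x
      obtain ⟨K, hK, hKx⟩ := exists_compact_mem_nhds x.1
      refine ⟨Prod.fst ⁻¹' K, continuous_fst.continuousAt.preimage_mem_nhds hKx, ?_⟩
      have hfin := hHlf (f '' K) (hK.image hf.continuous)
      refine ((hfin.image some).insert none).subset ?_
      rintro (_ | n) ⟨y, hy1, hy2⟩
      · exact Set.mem_insert _ _
      · refine Set.mem_insert_of_mem _ ⟨n, ⟨f y.1, ⟨(⟨y.1, hy1⟩, 0), hH0 n y.1 hy1⟩, ?_⟩, rfl⟩
        exact ⟨y.1, hy2, rfl⟩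
    refine hlf.continuous ?_ ?_ ?_
    · ext x
      simp only [Set.mem_iUnion, Set.mem_univ, iff_true]
      by_cases hx : ∃ n, x.1 ∈ S n
      · obtain ⟨n, hn⟩ := hx
        exact ⟨some n, hn⟩
      · refine ⟨none, ?_⟩
        intro h
        obtain ⟨n, hn⟩ := Set.mem_iUnion.1 h
        exact hx ⟨n, interior_subset hn⟩
    · rintro (_ | n)
      · exact (isOpen_iUnion fun n => isOpen_interior).isClosed_compl.preimage continuous_fst
      · exact (hScpt n).isClosed.preimage continuous_fst
    · rintro (_ | n)
      · have : Set.EqOn H (fun x => f x.1) (C none) := by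
          rintro ⟨p, t⟩ hx
          by_cases h : ∃ n, p ∈ S n
          · obtain ⟨n, hn⟩ := h
            rw [hHin n p hn]
            refine hHrel n p hn ?_ t
            by_contra hb
            exact hx (Set.mem_iUnion.2 ⟨n, not_boundary_interior hM (S n) p hn hb⟩)
          · push Not at h
            exact hHout p h t
        exact (hf.continuous.comp continuous_fst).continuousOn.congr this
      · rw [continuousOn_iff_continuous_domRestrict]
        have : (C (some n)).domRestrict H =
            fun x : C (some n) => Hfam n (⟨x.1.1, x.2⟩, x.1.2) := by
          funext x
          exact hHin n x.1.1 x.2 x.1.2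
        rw [this]
        exact (hHcont n).comp (((continuous_fst.comp continuous_subtype_val).subtype_mk _).prodMk
          (continuous_snd.comp continuous_subtype_val))
  rw [isProperMap_iff_isCompact_preimage]
  refine ⟨hcont, fun K hK => ?_⟩
  have hc1 : IsCompact ((f ⁻¹' K) ∪
      ⋃ n ∈ {n : ℕ | (Set.range (Hfam n) ∩ K).Nonempty}, S n) :=
    (hf.isCompact_preimage hK).union ((hHlf K hK).isCompact_biUnion fun n _ => hScpt n)
  refine (hc1.prod (isCompact_univ (X := unitInterval))).of_isClosed_subset
    (hK.isClosed.preimage hcont) ?_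
  rintro ⟨p, t⟩ hx
  refine ⟨?_, Set.mem_univ _⟩
  by_cases h : ∃ n, p ∈ S n
  · obtain ⟨n, hn⟩ := h
    refine Or.inr (Set.mem_biUnion (x := n) ?_ hn)
    exact ⟨H (p, t), ⟨(⟨p, hn⟩, t), (hHin n p hn t).symm⟩, hx⟩
  · push Not at h
    refine Or.inl ?_
    have := hHout p h t
    change f p ∈ K
    rw [← this]
    exact hx
end

section
/- Let Σ be a surface and let {Cᵢ : i ∈ ℕ} be a locally finite, pairwise disjoint collection of smoothly embedded circles on Σ such that for each i, the circle Cᵢ bounds an embedded closed disk Dᵢ ⊂ Σ with Cᵢ contained in the interior of Dᵢ₊₁. Then Σ is homeomorphic to ℝ². -/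
/-- A circle on `X`: the image of an embedding of `S¹`. -/
def IsEmbeddedCircle {X : Type*} [TopologicalSpace X] (C : Set X) : Prop :=
  ∃ e : Circle → X, Topology.IsEmbedding e ∧ Set.range e = C

/-- The circle `C` bounds the embedded closed disk `D` in `X`: there is an embedding of
the closed unit disk with image `D` whose restriction to the unit circle has image `C`. -/
def BoundsDisk {X : Type*} [TopologicalSpace X] (C D : Set X) : Prop :=
  ∃ e : (Metric.closedBall (0 : ℂ) 1) → X, Topology.IsEmbedding e ∧
    Set.range e = D ∧
    e '' {x : (Metric.closedBall (0 : ℂ) 1) | ‖(x : ℂ)‖ = 1} = C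

section Helpers
open Set Metric Topology Filter


def HasLog {X : Type*} [TopologicalSpace X] (g : X → ℂ) : Prop :=
  ∃ φ : X → ℂ, Continuous φ ∧ ∀ x, Complex.exp (φ x) = g x

lemma HasLog.of_close {X : Type*} [TopologicalSpace X] {g h : X → ℂ} (hg : HasLog g)
    (cg : Continuous g) (ch : Continuous h) (h0 : ∀ x, h x ≠ 0)
    (hc : ∀ x, ‖h x / g x - 1‖ < 1) : HasLog h := by
  obtain ⟨φ, hφ, he⟩ := hg
  have g0 : ∀ x, g x ≠ 0 := fun x => by rw [← he]; exact Complex.exp_ne_zero _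
  refine ⟨fun x => φ x + Complex.log (h x / g x), ?_, ?_⟩
  · refine hφ.add ((ch.div cg g0).clog ?_)
    intro x
    apply Complex.ball_one_subset_slitPlane
    simpa [dist_eq_norm] using hc x
  · intro x
    rw [Complex.exp_add, he, Complex.exp_log (div_ne_zero (h0 x) (g0 x))]
    field_simp [g0 x]

lemma HasLog.homotopy {X : Type*} [TopologicalSpace X] [CompactSpace X]
    (H : unitInterval → X → ℂ) (hH : Continuous (Function.uncurry H))
    (h0 : ∀ t x, H t x ≠ 0) (h : HasLog (H 0)) : HasLog (H 1) := by
  have hc : ∀ t, Continuous (H t) := fun t => hH.comp (by fun_prop : Continuous fun x => (t, x))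
  have key : ∀ t, ∀ᶠ s in 𝓝 t, ∀ x, ‖H s x / H t x - 1‖ < 1 ∧ ‖H t x / H s x - 1‖ < 1 := by
    intro t
    have := (isCompact_univ (X := X)).eventually_forall_of_forall_eventually
      (x₀ := t) (P := fun s x => ‖H s x / H t x - 1‖ < 1 ∧ ‖H t x / H s x - 1‖ < 1) ?_
    · simpa using this
    · intro x _
      have c1 : Continuous fun z : unitInterval × X => H z.1 z.2 := hH
      have c2 : Continuous fun z : unitInterval × X => H t z.2 := (hc t).comp continuous_snd
      have d1 : Continuous fun z : unitInterval × X => ‖H z.1 z.2 / H t z.2 - 1‖ :=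
        ((c1.div c2 (fun z => h0 _ _)).sub continuous_const).norm
      have d2 : Continuous fun z : unitInterval × X => ‖H t z.2 / H z.1 z.2 - 1‖ :=
        ((c2.div c1 (fun z => h0 _ _)).sub continuous_const).norm
      refine (d1.continuousAt.eventually_lt continuousAt_const ?_).and
        (d2.continuousAt.eventually_lt continuousAt_const ?_) <;>
      simp [div_self (h0 t x)]
  have lc : IsLocallyConstant (fun t => HasLog (H t)) := by
    rw [IsLocallyConstant.iff_eventually_eq]
    intro t
    filter_upwards [key t] with s hs
    exact propext ⟨fun hl => hl.of_close (hc s) (hc t) (h0 t) (fun x => (hs x).2),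
      fun hl => hl.of_close (hc t) (hc s) (h0 s) (fun x => (hs x).1)⟩
  have := lc.apply_eq_of_preconnectedSpace 0 1
  exact this ▸ h

lemma not_hasLog_odd (g : sphere (0:ℂ) 1 → ℂ) (hg : ∀ x, g (-x) = - g x) : ¬ HasLog g := by
  rintro ⟨φ, hφ, he⟩
  have hs : PreconnectedSpace (sphere (0:ℂ) 1) :=
    Subtype.preconnectedSpace (isPreconnected_sphere (by simp [Complex.rank_real_complex]) 0 1)
  let ψ : sphere (0:ℂ) 1 → ℝ := fun x => (φ (-x) - φ x).im
  have hψ : Continuous ψ := Complex.continuous_im.comp ((hφ.comp continuous_neg).sub hφ)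
  have hodd : ∀ x, ψ (-x) = - ψ x := fun x => by simp [ψ]
  let a : sphere (0:ℂ) 1 := ⟨1, by simp⟩
  have : ∃ x, ψ x = 0 := by
    rcases le_total (ψ a) 0 with h | h
    · exact mem_range_of_exists_le_of_exists_ge hψ ⟨a, h⟩ ⟨-a, by rw [hodd]; linarith⟩
    · exact mem_range_of_exists_le_of_exists_ge hψ ⟨-a, by rw [hodd]; linarith⟩ ⟨a, h⟩
  obtain ⟨x, hx⟩ := this
  have h1 : Complex.exp (φ (-x) - φ x) = -1 := by
    rw [Complex.exp_sub, he, he, hg]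
    have : g x ≠ 0 := by rw [← he]; exact Complex.exp_ne_zero _
    field_simp
  have h2 := congrArg Complex.re h1
  rw [Complex.exp_re] at h2
  change (φ (-x) - φ x).im = 0 at hx
  rw [hx] at h2
  simp at h2
  have := Real.exp_pos ((φ (-x)).re - (φ x).re)
  linarith

/-- Invariance of domain in the plane. -/
lemma invariance_of_domain (f : ℂ → ℂ) (hf : ContinuousOn f (closedBall 0 1))
    (hi : InjOn f (closedBall 0 1)) : f '' closedBall 0 1 ∈ 𝓝 (f 0) := by
  by_contra hn
  -- `f x - f 0` on the circle has no logarithm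
  have n0 : ∀ x : sphere (0:ℂ) 1, ‖(x:ℂ)‖ = 1 := fun x => by simp
  have cs : ∀ (k : unitInterval × sphere (0:ℂ) 1 → ℂ), Continuous k → (∀ z, ‖k z‖ ≤ 1) →
      Continuous (fun z => f (k z)) := fun k hk hb =>
    hf.comp_continuous hk (fun z => by simpa using hb z)
  have tle : ∀ t : unitInterval, ‖((t:ℝ):ℂ)‖ ≤ 1 := fun t => by
    rw [Complex.norm_real, Real.norm_eq_abs, abs_of_nonneg t.2.1]; exact t.2.2
  have hnl : ¬ HasLog (fun x : sphere (0:ℂ) 1 => f x - f 0) := by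
    intro hl
    refine not_hasLog_odd (fun x => f x - f (-x)) (fun x => by simp) ?_
    have := HasLog.homotopy (fun (t : unitInterval) (x : sphere (0:ℂ) 1) =>
      f x - f (-((t:ℝ):ℂ) * x)) ?_ ?_ (by simpa using hl)
    · simpa using this
    · refine (cs (fun z => z.2) (by fun_prop) (by simp [n0])).sub
        (cs (fun z => -((z.1:ℝ):ℂ) * z.2) (by fun_prop) ?_)
      intro z; simpa [n0] using tle z.1
    · intro t x h
      have := hi (by simp [n0]) (by simpa [n0] using tle t) (sub_eq_zero.1 h)
      have hx : (x:ℂ) ≠ 0 := by rw [← norm_ne_zero_iff, n0]; norm_num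
      have h2 : (1 + ((t:ℝ):ℂ)) * x = 0 := by linear_combination this
      have h3 := (mul_eq_zero.1 h2).resolve_right hx
      have h4 := congrArg Complex.re h3
      simp at h4
      linarith [t.2.1]
  -- bound below
  have csph : Continuous fun x : sphere (0:ℂ) 1 => f x :=
    hf.comp_continuous continuous_subtype_val (fun x => by simp [n0])
  have hne : ∀ x : sphere (0:ℂ) 1, f x - f 0 ≠ 0 := by
    intro x h
    have := hi (by simp [n0]) (by simp) (sub_eq_zero.1 h)
    have h1 := n0 x
    rw [this] at h1; simp at h1
  obtain ⟨δ, hδ, hb⟩ : ∃ δ > 0, ∀ x : sphere (0:ℂ) 1, δ ≤ ‖f x - f 0‖ := by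
    have : Nonempty (sphere (0:ℂ) 1) := ⟨⟨1, by simp⟩⟩
    obtain ⟨x, _, hx⟩ := (isCompact_univ (X := sphere (0:ℂ) 1)).exists_isMinOn univ_nonempty
      (csph.sub continuous_const : Continuous fun x : sphere (0:ℂ) 1 => f x - f 0).norm.continuousOn
    exact ⟨_, norm_pos_iff.2 (hne x), fun y => hx (mem_univ y)⟩
  -- choose p
  obtain ⟨p, hp, hpn⟩ : ∃ p, dist p (f 0) < δ ∧ p ∉ f '' closedBall 0 1 := by
    by_contra! h
    exact hn (mem_of_superset (ball_mem_nhds _ hδ) (fun p hp => h p hp))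
  have hp0 : ∀ x ∈ closedBall (0:ℂ) 1, f x - p ≠ 0 := fun x hx h =>
    hpn ⟨x, hx, sub_eq_zero.1 h⟩
  apply hnl
  have hl : HasLog (fun x : sphere (0:ℂ) 1 => f x - p) := by
    have := HasLog.homotopy (fun (t : unitInterval) (x : sphere (0:ℂ) 1) =>
      f (((t:ℝ):ℂ) * x) - p) ?_ ?_ ?_
    · simpa using this
    · exact (cs (fun z => ((z.1:ℝ):ℂ) * z.2) (by fun_prop)
        (fun z => by simpa [n0] using tle z.1)).sub continuous_const
    · intro t x
      exact hp0 _ (by simpa [n0] using tle t)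
    · refine ⟨fun _ => Complex.log (f 0 - p), continuous_const, fun x => ?_⟩
      rw [Complex.exp_log (hp0 0 (by simp))]; simp
  -- close
  have : HasLog (fun x : sphere (0:ℂ) 1 => (f x - p)⁻¹) := by
    obtain ⟨φ, h1, h2⟩ := hl
    exact ⟨fun x => - φ x, h1.neg, fun x => by rw [Complex.exp_neg, h2]⟩
  have c1 : Continuous fun x : sphere (0:ℂ) 1 => (f x - p)⁻¹ :=
    Continuous.inv₀ (csph.sub continuous_const) (fun x => hp0 x (by simp [n0]))
  have c2 : Continuous fun x : sphere (0:ℂ) 1 => (f x - f 0)⁻¹ :=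
    Continuous.inv₀ (csph.sub continuous_const) hne
  have h3 := this.of_close c1 c2 (fun x => inv_ne_zero (hne x)) ?_
  · obtain ⟨φ, h1, h2⟩ := h3
    exact ⟨fun x => - φ x, h1.neg, fun x => by rw [Complex.exp_neg, h2, inv_inv]⟩
  · intro x
    have e : (f x - f 0)⁻¹ / (f x - p)⁻¹ - 1 = (f 0 - p) / (f x - f 0) := by
      have := hne x
      field_simp
      ring
    rw [e, norm_div, div_lt_one (norm_pos_iff.2 (hne x))]
    refine lt_of_lt_of_le ?_ (hb x)
    rwa [dist_comm, dist_eq_norm] at hp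


lemma exists_line_squeeze (a' a R : ℝ) (h1 : 0 < a') (h2 : a' < a) (h3 : a < R) :
    ∃ k : ℝ ≃o ℝ, (∀ t ≤ a', k t = t) ∧ (∀ t, R + 1 ≤ t → k t = t) ∧ k R = a := by
  obtain ⟨m, hm⟩ : ∃ m, m = (a - a') / (R - a') := ⟨_, rfl⟩
  have hmR : m * (R - a') = a - a' := by rw [hm]; field_simp [show R - a' ≠ 0 by linarith]
  have m0 : 0 < m := by rw [hm]; apply div_pos <;> linarith
  have m1 : m < 1 := by rw [hm, div_lt_one] <;> linarith
  let k : ℝ → ℝ := fun t => max (min t (a' + m * (t - a')))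
    (min t (R + 1 + (R + 1 - a) * (t - (R + 1))))
  have e1 : ∀ t ≤ a', k t = t := by
    intro t ht
    simp only [k]
    rw [min_eq_left (by nlinarith)]
    exact max_eq_left (min_le_left _ _)
  have e2 : ∀ t, R + 1 ≤ t → k t = t := by
    intro t ht
    simp only [k]
    rw [min_eq_left (b := R + 1 + (R + 1 - a) * (t - (R + 1))) (by nlinarith)]
    exact max_eq_right (min_le_left _ _)
  have e3 : k R = a := by
    simp only [k]
    rw [hmR]
    rw [min_eq_right (by linarith), min_eq_right (by linarith)]
    ring_nf
    simp
  have mono : StrictMono k := by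
    intro x y hxy
    refine max_lt_max (lt_min ?_ ?_) (lt_min ?_ ?_)
    · exact (min_le_left _ _).trans_lt hxy
    · exact (min_le_right _ _).trans_lt (by nlinarith)
    · exact (min_le_left _ _).trans_lt hxy
    · exact (min_le_right _ _).trans_lt (by nlinarith)
  have cont : Continuous k := by simp only [k]; fun_prop
  have surj : Function.Surjective k := by
    refine cont.surjective ?_ ?_
    · refine tendsto_id.congr' ?_
      filter_upwards [eventually_ge_atTop (R + 1)] with t ht using (e2 t ht).symm
    · refine tendsto_id.congr' ?_
      filter_upwards [eventually_le_atBot a'] with t ht using (e1 t ht).symm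
  exact ⟨mono.orderIsoOfSurjective k surj, e1, e2, e3⟩

lemma radial_continuous (k : ℝ ≃o ℝ) (a' : ℝ) (h : 0 < a') (hk : ∀ t ≤ a', k t = t) :
    Continuous (fun z : ℂ => (k ‖z‖ / ‖z‖) • z) := by
  have kc : Continuous k := k.continuous
  rw [continuous_iff_continuousAt]
  intro z
  by_cases hz : z = 0
  · have : (fun z : ℂ => (k ‖z‖ / ‖z‖) • z) =ᶠ[𝓝 z] id := by
      filter_upwards [(isOpen_ball (x := (0:ℂ)) (ε := a')).mem_nhds (by simpa [hz] using h)]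
        with w hw
      have hw' : ‖w‖ < a' := by simpa using hw
      rw [hk _ hw'.le]
      by_cases hw0 : w = 0
      · simp [hw0]
      · rw [div_self (norm_ne_zero_iff.2 hw0)]; simp
    exact continuousAt_id.congr this.symm
  · have : ‖z‖ ≠ 0 := norm_ne_zero_iff.2 hz
    have h1 : ContinuousAt (fun z : ℂ => k ‖z‖ / ‖z‖) z :=
      (kc.comp continuous_norm).continuousAt.div continuous_norm.continuousAt this
    exact h1.smul continuousAt_id

lemma exists_squeeze (a' a R : ℝ) (h1 : 0 < a') (h2 : a' < a) (h3 : a < R) :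
    ∃ ρ : ℂ ≃ₜ ℂ, (∀ z, ‖z‖ ≤ a' → ρ z = z) ∧ (∀ z, R + 1 ≤ ‖z‖ → ρ z = z) ∧
      ∀ z, ‖z‖ ≤ R → ‖ρ z‖ ≤ a := by
  obtain ⟨k, k1, k2, k3⟩ := exists_line_squeeze a' a R h1 h2 h3
  have ks1 : ∀ t ≤ a', k.symm t = t := fun t ht => by rw [OrderIso.symm_apply_eq, k1 t ht]
  have k0 : k 0 = 0 := k1 0 h1.le
  have ks0 : k.symm 0 = 0 := ks1 0 h1.le
  have inv : ∀ (p q : ℝ ≃o ℝ), p 0 = 0 → (∀ t, q (p t) = t) → ∀ z : ℂ,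
      (q ‖(p ‖z‖ / ‖z‖) • z‖ / ‖(p ‖z‖ / ‖z‖) • z‖) • ((p ‖z‖ / ‖z‖) • z) = z := by
    intro p q p0 hpq z
    by_cases hz : z = 0
    · simp [hz]
    have hz' : 0 < ‖z‖ := norm_pos_iff.2 hz
    have hp : 0 < p ‖z‖ := by rw [← p0]; exact p.strictMono hz'
    have hn : ‖(p ‖z‖ / ‖z‖) • z‖ = p ‖z‖ := by
      rw [norm_smul, Real.norm_eq_abs, abs_of_pos (div_pos hp hz')]; field_simp
    rw [hn, hpq, smul_smul]
    have : ‖z‖ / p ‖z‖ * (p ‖z‖ / ‖z‖) = 1 := by field_simp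
    rw [this, one_smul]
  let ρ : ℂ ≃ₜ ℂ :=
    { toFun := fun z => (k ‖z‖ / ‖z‖) • z
      invFun := fun z => (k.symm ‖z‖ / ‖z‖) • z
      left_inv := fun z => inv k k.symm k0 (by simp) z
      right_inv := fun z => inv k.symm k ks0 (by simp) z
      continuous_toFun := radial_continuous k a' h1 k1
      continuous_invFun := radial_continuous k.symm a' h1 ks1 }
  have fixed : ∀ z, k ‖z‖ = ‖z‖ → ρ z = z := by
    intro z hz
    change (k ‖z‖ / ‖z‖) • z = z
    by_cases hw0 : z = 0
    · simp [hw0]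
    · rw [hz, div_self (norm_ne_zero_iff.2 hw0), one_smul]
  refine ⟨ρ, fun z hz => fixed z (k1 _ hz), fun z hz => fixed z (k2 _ hz), fun z hz => ?_⟩
  change ‖(k ‖z‖ / ‖z‖) • z‖ ≤ a
  by_cases hz0 : z = 0
  · simp [hz0]; linarith
  have hz' : 0 < ‖z‖ := norm_pos_iff.2 hz0
  have hp : 0 < k ‖z‖ := by rw [← k0]; exact k.strictMono hz'
  have hn : ‖(k ‖z‖ / ‖z‖) • z‖ = k ‖z‖ := by
    rw [norm_smul, Real.norm_eq_abs, abs_of_pos (div_pos hp hz')]; field_simp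
  rw [hn, ← k3]
  exact k.monotone hz

lemma exists_extend {S : Type*} [TopologicalSpace S] [T2Space S] (g : ℂ → S)
    (hg : IsOpenEmbedding g) (ρ : ℂ ≃ₜ ℂ) (R : ℝ) (hρ : ∀ z, R ≤ ‖z‖ → ρ z = z) :
    ∃ σ : S ≃ₜ S, (∀ z, σ (g z) = g (ρ z)) ∧ ∀ x, x ∉ g '' closedBall 0 R → σ x = x := by
  classical
  let ext : (ℂ → ℂ) → S → S := fun r x => if h : ∃ z, g z = x then g (r h.choose) else x
  have ext_g : ∀ r z, ext r (g z) = g (r z) := by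
    intro r z
    have h : ∃ w, g w = g z := ⟨z, rfl⟩
    simp only [ext, dif_pos h, hg.injective h.choose_spec]
  have ext_n : ∀ r x, x ∉ range g → ext r x = x := by
    intro r x hx
    exact dif_neg hx
  have ext_o : ∀ r : ℂ → ℂ, (∀ z, R ≤ ‖z‖ → r z = z) → ∀ x, x ∉ g '' closedBall 0 R →
      ext r x = x := by
    intro r hr x hx
    by_cases h : x ∈ range g
    · obtain ⟨z, rfl⟩ := h
      rw [ext_g, hr]
      by_contra hz
      exact hx ⟨z, by simpa using (not_le.1 hz).le, rfl⟩
    · exact ext_n r x h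
  have ext_c : ∀ r : ℂ → ℂ, Continuous r → (∀ z, R ≤ ‖z‖ → r z = z) → Continuous (ext r) := by
    intro r rc hr
    rw [continuous_iff_continuousAt]
    intro x
    by_cases h : x ∈ range g
    · obtain ⟨z, rfl⟩ := h
      rw [← hg.continuousAt_iff]
      have : ext r ∘ g = g ∘ r := funext fun z => ext_g r z
      rw [this]
      exact (hg.continuous.comp rc).continuousAt
    · have hcl : IsClosed (g '' closedBall 0 R) :=
        ((isCompact_closedBall 0 R).image hg.continuous).isClosed
      have hx : x ∈ (g '' closedBall 0 R)ᶜ := fun h' => h (image_subset_range _ _ h')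
      refine continuousAt_id.congr ?_
      filter_upwards [hcl.isOpen_compl.mem_nhds hx] with y hy using (ext_o r hr y hy).symm
  have inv : ∀ p q : ℂ → ℂ, (∀ z, q (p z) = z) → ∀ x, ext q (ext p x) = x := by
    intro p q h x
    by_cases hx : x ∈ range g
    · obtain ⟨z, rfl⟩ := hx
      rw [ext_g, ext_g, h]
    · rw [ext_n p x hx, ext_n q x hx]
  refine ⟨{ toFun := ext ρ
            invFun := ext ρ.symm
            left_inv := inv _ _ (by simp)
            right_inv := inv _ _ (by simp)
            continuous_toFun := ext_c _ ρ.continuous hρ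
            continuous_invFun := ext_c _ ρ.symm.continuous ?_ }, ext_g ρ, ext_o ρ hρ⟩
  intro z hz
  rw [Homeomorph.symm_apply_eq, hρ z hz]

lemma exists_radius {S : Type*} [TopologicalSpace S] (g : ℂ → S)
    (hg : IsOpenEmbedding g) (K : Set S) (hK : IsCompact K) (hKg : K ⊆ range g) (r₀ : ℝ) :
    ∃ R > r₀, K ⊆ g '' closedBall 0 R := by
  have hc : IsCompact (g ⁻¹' K) := hg.isInducing.isCompact_preimage' hK hKg
  obtain ⟨R, hR⟩ := hc.isBounded.subset_closedBall 0
  refine ⟨max R (r₀ + 1), lt_max_of_lt_right (by linarith), fun x hx => ?_⟩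
  obtain ⟨z, rfl⟩ := hKg hx
  exact ⟨z, closedBall_subset_closedBall (le_max_left _ _) (hR hx), rfl⟩

lemma exists_small {S : Type*} [TopologicalSpace S] (g : ℂ → S)
    (hg : Continuous g) (U : Set S) (hU : U ∈ 𝓝 (g 0)) (r₀ : ℝ) (hr : 0 < r₀) :
    ∃ ε > 0, ε < r₀ ∧ ∀ z, ‖z‖ ≤ ε → g z ∈ U := by
  have := hg.continuousAt.preimage_mem_nhds hU
  obtain ⟨ε, h0, h⟩ := Metric.mem_nhds_iff.1 this
  refine ⟨min ε r₀ / 2, by positivity, ?_, fun z hz => h ?_⟩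
  · have := min_le_right ε r₀; linarith
  · have := min_le_left ε r₀
    have h3 : 0 < min ε r₀ := by positivity
    simp only [mem_ball, dist_zero_right]; linarith

lemma brown_step {S : Type*} [TopologicalSpace S] [T2Space S] (f g : ℂ → S)
    (hf : IsOpenEmbedding f) (hg : IsOpenEmbedding g) (r : ℝ) (hr : 0 < r)
    (hfg : f '' closedBall 0 (r + 1) ⊆ range g) (h0 : f 0 = g 0)
    (K : Set S) (hK : IsCompact K) (hKg : K ⊆ range g) :
    ∃ f' : ℂ → S, IsOpenEmbedding f' ∧ EqOn f' f (closedBall 0 r) ∧ K ⊆ range f' := by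
  obtain ⟨ε, e0, -, he⟩ := exists_small g hg.continuous (range f)
    (hf.isOpen_range.mem_nhds (h0 ▸ mem_range_self 0)) 1 one_pos
  have hnb : g '' ball 0 (ε / 2) ∈ 𝓝 (f 0) :=
    (hg.isOpenMap _ isOpen_ball).mem_nhds ⟨0, by simpa using e0, h0.symm⟩
  obtain ⟨a, a0, har, ha⟩ := exists_small f hf.continuous _ hnb r hr
  obtain ⟨ρ, -, ρ2, ρ3⟩ := exists_squeeze (a / 2) a r (by linarith) (by linarith) har
  obtain ⟨τ, τ1, τ2⟩ := exists_extend f hf ρ (r + 1) ρ2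
  have hτK : τ '' K ⊆ range g := by
    rintro _ ⟨x, hx, rfl⟩
    by_contra hn
    have h1 := τ2 (τ x) (fun h => hn (hfg h))
    rw [τ.injective h1] at hn
    exact hn (hKg hx)
  obtain ⟨R, hR, hKR⟩ := exists_radius g hg _ (hK.image τ.continuous) hτK ε
  obtain ⟨s, s1, s2, s3⟩ := exists_squeeze (ε / 2) ε R (by linarith) (by linarith) hR
  obtain ⟨σ, σ1, σ2⟩ := exists_extend g hg s (R + 1) s2
  refine ⟨fun z => τ.symm (σ.symm (τ (f z))), ?_, ?_, ?_⟩
  · exact τ.symm.isOpenEmbedding.comp (σ.symm.isOpenEmbedding.comp (τ.isOpenEmbedding.comp hf))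
  · intro z hz
    have hz' : ‖z‖ ≤ r := by simpa using hz
    obtain ⟨w, hw, hwe⟩ := ha (ρ z) (ρ3 z hz')
    have hw' : ‖w‖ ≤ ε / 2 := by simpa using (mem_ball.1 hw).le
    change τ.symm (σ.symm (τ (f z))) = f z
    rw [Homeomorph.symm_apply_eq, Homeomorph.symm_apply_eq, τ1, ← hwe, σ1, s1 w hw']
  · intro x hx
    obtain ⟨w, hw, hwe⟩ := hKR (mem_image_of_mem τ hx)
    obtain ⟨v, hv⟩ := he (s w) (s3 w (by simpa using hw))
    refine ⟨ρ.symm v, ?_⟩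
    change τ.symm (σ.symm (τ (f (ρ.symm v)))) = x
    rw [Homeomorph.symm_apply_eq, Homeomorph.symm_apply_eq, τ1, ← hwe, σ1, ← hv]
    simp

/-- Brown: a monotone union of open cells is an open cell. -/
lemma brown {S : Type*} [TopologicalSpace S] [T2Space S] (K : ℕ → Set S)
    (hK : ∀ n, IsCompact (K n)) (hKu : ∀ x, ∃ n, x ∈ K n)
    (hcell : ∀ L : Set S, IsCompact L → ∃ g : ℂ → S, IsOpenEmbedding g ∧ L ⊆ range g) :
    Nonempty (S ≃ₜ ℂ) := by
  let P : ℕ → (ℂ → S) × ℝ → Prop := fun n p =>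
    IsOpenEmbedding p.1 ∧ K n ⊆ p.1 '' closedBall 0 p.2 ∧ (n:ℝ) + 1 ≤ p.2
  have base : ∃ p, P 0 p := by
    obtain ⟨g, hg, h⟩ := hcell (K 0) (hK 0)
    obtain ⟨R, hR, h2⟩ := exists_radius g hg _ (hK 0) h 1
    exact ⟨(g, R), hg, h2, by simpa using hR.le⟩
  have step : ∀ n p, P n p → ∃ q, P (n + 1) q ∧ p.2 ≤ q.2 ∧ EqOn q.1 p.1 (closedBall 0 p.2) := by
    rintro n ⟨f, r⟩ ⟨hf, -, hr⟩
    simp only at hf hr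
    have hr0 : 0 < r := by have : (0:ℝ) ≤ n := n.cast_nonneg; linarith
    have hLc := ((isCompact_closedBall (0:ℂ) (r + 1)).image hf.continuous)
    obtain ⟨g, hg, h⟩ := hcell _ (hLc.union (hK (n + 1)))
    obtain ⟨c, hc⟩ := h (Or.inl ⟨0, by simp; linarith, rfl⟩)
    have hg' : IsOpenEmbedding (g ∘ (Homeomorph.addLeft c)) :=
      hg.comp (Homeomorph.addLeft c).isOpenEmbedding
    have hrg : range (g ∘ (Homeomorph.addLeft c)) = range g :=
      (Homeomorph.addLeft c).surjective.range_comp g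
    obtain ⟨f', h1, h2, h3⟩ := brown_step f _ hf hg' r hr0
      (by rw [hrg]; exact subset_union_left.trans h) (by simp [hc]) (K (n + 1)) (hK _)
      (by rw [hrg]; exact subset_union_right.trans h)
    obtain ⟨R, hR, h4⟩ := exists_radius f' h1 _ (hK (n + 1)) h3 (r + 1)
    refine ⟨(f', R), ⟨h1, h4, ?_⟩, ?_, h2⟩
    · push_cast; linarith
    · simp only; linarith
  choose nxt hnxt using step
  obtain ⟨p0, hp0⟩ := base
  let seq : ∀ n, {p // P n p} := fun n =>
    Nat.rec ⟨p0, hp0⟩ (fun n p => ⟨nxt n p.1 p.2, (hnxt n p.1 p.2).1⟩) n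
  let F : ℕ → ℂ → S := fun n => (seq n).1.1
  let r : ℕ → ℝ := fun n => (seq n).1.2
  have hF : ∀ n, IsOpenEmbedding (F n) := fun n => (seq n).2.1
  have hKF : ∀ n, K n ⊆ F n '' closedBall 0 (r n) := fun n => (seq n).2.2.1
  have hrn : ∀ n : ℕ, (n:ℝ) + 1 ≤ r n := fun n => (seq n).2.2.2
  have hmono : Monotone r := monotone_nat_of_le_succ fun n =>
    (hnxt n (seq n).1 (seq n).2).2.1
  have heq1 : ∀ n, EqOn (F (n + 1)) (F n) (closedBall 0 (r n)) := fun n =>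
    (hnxt n (seq n).1 (seq n).2).2.2
  have heq : ∀ n m, n ≤ m → EqOn (F m) (F n) (closedBall 0 (r n)) := by
    intro n m h
    induction m, h using Nat.le_induction with
    | base => exact fun _ _ => rfl
    | succ m hm ih =>
      intro z hz
      rw [heq1 m (closedBall_subset_closedBall (hmono hm) hz), ih hz]
  let G : ℂ → S := fun z => F ⌈‖z‖⌉₊ z
  have hG : ∀ n, ∀ z ∈ closedBall (0:ℂ) (r n), G z = F n z := by
    intro n z hz
    rcases le_total n ⌈‖z‖⌉₊ with h | h
    · exact heq _ _ h hz
    · refine (heq _ _ h ?_).symm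
      have := Nat.le_ceil ‖z‖
      have := hrn ⌈‖z‖⌉₊
      simp only [mem_closedBall, dist_zero_right]
      linarith
  have hin : ∀ z : ℂ, ∀ n, ⌈‖z‖⌉₊ ≤ n → z ∈ ball (0:ℂ) (r n) := by
    intro z n h
    have := Nat.le_ceil ‖z‖
    have := hrn n
    have : (⌈‖z‖⌉₊:ℝ) ≤ n := by exact_mod_cast h
    simp only [mem_ball, dist_zero_right]
    linarith
  have inj : Function.Injective G := by
    intro x y hxy
    have hx := ball_subset_closedBall (hin x _ (le_max_left ⌈‖x‖⌉₊ ⌈‖y‖⌉₊))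
    have hy := ball_subset_closedBall (hin y _ (le_max_right ⌈‖x‖⌉₊ ⌈‖y‖⌉₊))
    rw [hG _ x hx, hG _ y hy] at hxy
    exact (hF _).injective hxy
  have surj : Function.Surjective G := by
    intro x
    obtain ⟨n, hn⟩ := hKu x
    obtain ⟨z, hz, rfl⟩ := hKF n hn
    exact ⟨z, hG n z hz⟩
  have nh : ∀ z, map G (𝓝 z) = 𝓝 (G z) := by
    intro z
    have h1 := hin z _ le_rfl
    have : G =ᶠ[𝓝 z] F ⌈‖z‖⌉₊ := by
      filter_upwards [isOpen_ball.mem_nhds h1] with w hw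
        using hG _ w (ball_subset_closedBall hw)
    rw [map_congr this, (hF _).map_nhds_eq]
  have cont : Continuous G := continuous_iff_continuousAt.2 fun z => (nh z).le
  have opn : IsOpenMap G := IsOpenMap.of_nhds_le fun z => (nh z).ge
  exact ⟨((Equiv.ofBijective G ⟨inj, surj⟩).toHomeomorphOfContinuousOpen cont opn).symm⟩

lemma invariance_of_domain' (f : closedBall (0:ℂ) 1 → ℂ) (hf : Continuous f)
    (hi : Function.Injective f) (o : closedBall (0:ℂ) 1) (ho : (o : ℂ) = 0) :
    range f ∈ 𝓝 (f o) := by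
  classical
  let F : ℂ → ℂ := fun z => if h : z ∈ closedBall (0:ℂ) 1 then f ⟨z, h⟩ else 0
  have hF : ∀ x : closedBall (0:ℂ) 1, F x = f x := fun x => dif_pos x.2
  have h1 : ContinuousOn F (closedBall 0 1) := by
    rw [continuousOn_iff_continuous_domRestrict]
    exact hf.congr (fun x => (hF x).symm)
  have h2 : InjOn F (closedBall 0 1) := by
    intro x hx y hy hxy
    have := hi ((hF ⟨x, hx⟩).symm.trans (hxy.trans (hF ⟨y, hy⟩)))
    exact congrArg Subtype.val this
  have h3 := invariance_of_domain F h1 h2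
  rw [← ho, hF] at h3
  refine mem_of_superset h3 ?_
  rw [ho]
  rintro _ ⟨x, hx, rfl⟩
  exact ⟨⟨x, hx⟩, (hF ⟨x, hx⟩).symm⟩

lemma disk_open {S : Type*} [TopologicalSpace S]
    (hS : ∀ x : S, ∃ U : Set S, IsOpen U ∧ x ∈ U ∧ Nonempty (U ≃ₜ (ℝ × ℝ)))
    (e : closedBall (0:ℂ) 1 → S) (he : IsEmbedding e) :
    IsOpen (e '' {x | ‖(x:ℂ)‖ < 1}) := by
  rw [isOpen_iff_mem_nhds]
  rintro _ ⟨z, hz, rfl⟩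
  have hz : ‖(z:ℂ)‖ < 1 := hz
  obtain ⟨U, hU, hxU, ⟨h⟩⟩ := hS (e z)
  have hpre : e ⁻¹' U ∈ 𝓝 z := he.continuous.continuousAt.preimage_mem_nhds (hU.mem_nhds hxU)
  obtain ⟨ε, ε0, hε⟩ := Metric.mem_nhds_iff.1 hpre
  obtain ⟨r, r0, r1, r2⟩ : ∃ r : ℝ, 0 < r ∧ ‖(z:ℂ)‖ + r < 1 ∧ r < ε :=
    ⟨min (1 - ‖(z:ℂ)‖) ε / 2, by have : 0 < 1 - ‖(z:ℂ)‖ := by linarith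
                                 positivity,
      by have := min_le_left (1 - ‖(z:ℂ)‖) ε; linarith,
      by have := min_le_right (1 - ‖(z:ℂ)‖) ε; linarith⟩
  have hb : ∀ w : closedBall (0:ℂ) 1, ‖(z:ℂ) + r * w‖ < 1 := by
    intro w
    have hw : ‖(w:ℂ)‖ ≤ 1 := mem_closedBall_zero_iff.1 w.2
    calc ‖(z:ℂ) + r * w‖ ≤ ‖(z:ℂ)‖ + ‖(r:ℂ) * w‖ := norm_add_le _ _
      _ = ‖(z:ℂ)‖ + r * ‖(w:ℂ)‖ := by rw [norm_mul, Complex.norm_real, Real.norm_eq_abs,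
        abs_of_pos r0]
      _ < 1 := by nlinarith
  let m : closedBall (0:ℂ) 1 → closedBall (0:ℂ) 1 := fun w =>
    ⟨(z:ℂ) + r * w, by simpa using (hb w).le⟩
  have mc : Continuous m := by
    apply Continuous.subtype_mk
    fun_prop
  have mi : Function.Injective m := by
    intro x y hxy
    have h1 := congrArg Subtype.val hxy
    simp only [m, add_right_inj] at h1
    have hr : (r:ℂ) ≠ 0 := by exact_mod_cast r0.ne'
    exact Subtype.ext (mul_left_cancel₀ hr h1)
  have mU : ∀ w, e (m w) ∈ U := by
    intro w
    apply hε
    have hw : ‖(w:ℂ)‖ ≤ 1 := mem_closedBall_zero_iff.1 w.2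
    rw [mem_ball, Subtype.dist_eq, dist_eq_norm]
    simp only [m, add_sub_cancel_left]
    rw [norm_mul, Complex.norm_real, Real.norm_eq_abs, abs_of_pos r0]
    nlinarith
  let q : U ≃ₜ ℂ := h.trans Complex.equivRealProdCLM.symm.toHomeomorph
  let f : closedBall (0:ℂ) 1 → ℂ := fun w => q ⟨e (m w), mU w⟩
  have fc : Continuous f := q.continuous.comp ((he.continuous.comp mc).subtype_mk _)
  have fi : Function.Injective f := by
    intro x y hxy
    exact mi (he.injective (congrArg Subtype.val (q.injective hxy)))
  let o : closedBall (0:ℂ) 1 := ⟨0, by simp⟩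
  have mo : m o = z := Subtype.ext (by simp [m, o])
  have key := invariance_of_domain' f fc fi o rfl
  let k : ℂ → S := fun w => (q.symm w : S)
  have kf : ∀ w, k (f w) = e (m w) := fun w => by simp [k, f]
  have ko : IsOpenEmbedding k := hU.isOpenEmbedding_subtypeVal.comp q.symm.isOpenEmbedding
  have h2 := ko.isOpenMap.image_mem_nhds key
  rw [kf, mo] at h2
  refine mem_of_superset h2 ?_
  rintro _ ⟨_, ⟨w, rfl⟩, rfl⟩
  rw [kf]
  exact ⟨m w, hb w, rfl⟩

lemma disk_facts {S : Type*} [TopologicalSpace S]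
    (hS : ∀ x : S, ∃ U : Set S, IsOpen U ∧ x ∈ U ∧ Nonempty (U ≃ₜ (ℝ × ℝ)))
    (C D : Set S) (h : BoundsDisk C D) :
    ∃ j : ℂ → S, IsOpenEmbedding j ∧ D = range j ∪ C ∧ Disjoint (range j) C ∧ IsCompact D ∧
      IsPreconnected D ∧ IsConnected C := by
  obtain ⟨e, he, hD, hC⟩ := h
  let i : ball (0:ℂ) 1 → closedBall (0:ℂ) 1 := inclusion ball_subset_closedBall
  have hi : IsEmbedding i := IsEmbedding.inclusion _
  have hr : range i = {x : closedBall (0:ℂ) 1 | ‖(x:ℂ)‖ < 1} := by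
    ext x
    constructor
    · rintro ⟨y, rfl⟩
      have : ‖(y:ℂ)‖ < 1 := mem_ball_zero_iff.1 y.2
      exact this
    · intro hx
      exact ⟨⟨x, by simpa using hx⟩, rfl⟩
  let j : ℂ → S := fun z => e (i (Homeomorph.unitBall z))
  have hj : IsEmbedding j := he.comp (hi.comp Homeomorph.unitBall.isEmbedding)
  have hjr : range j = e '' {x | ‖(x:ℂ)‖ < 1} := by
    rw [← hr, ← range_comp]
    exact Homeomorph.unitBall.surjective.range_comp (e ∘ i)
  have : CompactSpace (closedBall (0:ℂ) 1) := isCompact_iff_compactSpace.1 (isCompact_closedBall _ _)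
  have : PreconnectedSpace (closedBall (0:ℂ) 1) :=
    Subtype.preconnectedSpace (convex_closedBall _ _).isPreconnected
  refine ⟨j, ⟨hj, ?_⟩, ?_, ?_, ?_, ?_, ?_⟩
  · rw [hjr]; exact disk_open hS e he
  · rw [hjr, ← hC, ← image_union, ← hD, ← image_univ]
    congr 1
    ext x
    have : ‖(x:ℂ)‖ ≤ 1 := mem_closedBall_zero_iff.1 x.2
    simpa using lt_or_eq_of_le this
  · rw [hjr, ← hC, disjoint_image_iff he.injective, Set.disjoint_left]
    intro x hx hx'
    exact (ne_of_lt hx) hx'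
  · rw [← hD]; exact isCompact_range he.continuous
  · rw [← hD]; exact isPreconnected_range he.continuous
  · have hs : IsConnected (sphere (0:ℂ) 1) :=
      isConnected_sphere (by simp [Complex.rank_real_complex]) 0 zero_le_one
    have : ConnectedSpace (sphere (0:ℂ) 1) := Subtype.connectedSpace hs
    let s : sphere (0:ℂ) 1 → S := fun x => e (inclusion sphere_subset_closedBall x)
    have : C = range s := by
      rw [← hC]
      ext y
      constructor
      · rintro ⟨x, hx, rfl⟩
        have hx : ‖(x:ℂ)‖ = 1 := hx
        exact ⟨⟨x, by simpa using hx⟩, rfl⟩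
      · rintro ⟨x, rfl⟩
        have : ‖(x:ℂ)‖ = 1 := by simp
        exact ⟨_, this, rfl⟩
    rw [this]
    exact isConnected_range (he.continuous.comp (continuous_inclusion _))

end Helpers

open Set Metric Topology Filter in
/-- If a surface `Σ` carries a locally finite, pairwise disjoint collection of embedded
circles `Cᵢ` such that each `Cᵢ` bounds an embedded closed disk `Dᵢ` and `Cᵢ` lies in the
interior of `Dᵢ₊₁`, then `Σ` is homeomorphic to `ℝ²`. -/
theorem surface_with_concentric_circles_is_plane
    {S : Type*} [TopologicalSpace S] (hS : IsSurface S)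
    (C D : ℕ → Set S)
    (hC : ∀ i, IsEmbeddedCircle (C i))
    (hdisj : ∀ i j, i ≠ j → Disjoint (C i) (C j))
    (hlf : ∀ K : Set S, IsCompact K → {i : ℕ | (C i ∩ K).Nonempty}.Finite)
    (hD : ∀ i, BoundsDisk (C i) (D i))
    (hnest : ∀ i, C i ⊆ interior (D (i + 1))) :
    Nonempty (S ≃ₜ (ℝ × ℝ)) := by
  obtain ⟨hT2, hSC, hconn, hch⟩ := hS
  choose j hj hDj hdj hDc hDp hCc using fun i => disk_facts hch (C i) (D i) (hD i)
  have hO : ∀ i, IsOpen (range (j i)) := fun i => (hj i).isOpen_range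
  have hnc : ¬ IsCompact (univ : Set S) := by
    intro hc
    have := hlf univ hc
    have h2 : {i : ℕ | (C i ∩ univ).Nonempty} = univ := by
      ext i; simpa using (hCc i).nonempty
    rw [h2] at this
    exact infinite_univ this
  -- a connected set missing `C i` and meeting `range (j i)` is inside
  have hsep : ∀ i (A : Set S), IsPreconnected A → Disjoint A (C i) →
      (A ∩ range (j i)).Nonempty → A ⊆ range (j i) := by
    intro i A hA hAC hne
    refine hA.subset_left_of_subset_union (hO i) (hDc i).isClosed.isOpen_compl ?_ ?_ hne
    · rw [Set.disjoint_left]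
      intro x hx hx'
      exact hx' (by rw [hDj]; exact Or.inl hx)
    · intro x hx
      by_cases h : x ∈ D i
      · rw [hDj] at h
        exact h.elim Or.inl (fun h => (Set.disjoint_left.1 hAC hx h).elim)
      · exact Or.inr h
  have hCO : ∀ i, C i ⊆ range (j (i + 1)) := by
    intro i x hx
    have h1 : x ∈ D (i + 1) := interior_subset (hnest i hx)
    rw [hDj] at h1
    exact h1.resolve_right (Set.disjoint_left.1 (hdisj i (i + 1) (by omega)) hx)
  have hDO : ∀ i, D i ⊆ range (j (i + 1)) := by
    intro i
    by_cases hm : Disjoint (D i) (C (i + 1))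
    · refine hsep (i + 1) (D i) (hDp i) hm ?_
      obtain ⟨x, hx⟩ := (hCc i).nonempty
      exact ⟨x, by rw [hDj]; exact Or.inr hx, hCO i hx⟩
    · exfalso
      rw [Set.not_disjoint_iff] at hm
      obtain ⟨x, hxD, hxC⟩ := hm
      have hd := hdisj (i + 1) i (by omega)
      have hin : C (i + 1) ⊆ range (j i) := by
        refine hsep i _ (hCc (i + 1)).isPreconnected hd ⟨x, hxC, ?_⟩
        rw [hDj] at hxD
        exact hxD.resolve_right (Set.disjoint_left.1 hd hxC)
      have heq : D i ∪ D (i + 1) = range (j i) ∪ range (j (i + 1)) := by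
        rw [hDj i, hDj (i + 1)]
        have := hCO i
        ext y
        constructor
        · rintro ((h | h) | (h | h))
          · exact Or.inl h
          · exact Or.inr (this h)
          · exact Or.inr h
          · exact Or.inl (hin h)
        · rintro (h | h)
          · exact Or.inl (Or.inl h)
          · exact Or.inr (Or.inl h)
      have hcl : IsClopen (D i ∪ D (i + 1)) :=
        ⟨((hDc i).union (hDc (i + 1))).isClosed, by rw [heq]; exact (hO _).union (hO _)⟩
      have hu := hcl.eq_univ ⟨x, Or.inl hxD⟩
      exact hnc (hu ▸ (hDc i).union (hDc (i + 1)))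
  have hOD : ∀ i, range (j i) ⊆ D i := fun i => by rw [hDj]; exact subset_union_left
  have hmono : Monotone fun i => range (j i) :=
    monotone_nat_of_le_succ fun i => (hOD i).trans (hDO i)
  have hU : (⋃ i, range (j i)) = univ := by
    refine IsClopen.eq_univ ⟨?_, isOpen_iUnion hO⟩ ⟨j 0 0, mem_iUnion.2 ⟨0, 0, rfl⟩⟩
    refine isClosed_of_closure_subset fun x hx => ?_
    -- a compact connected neighbourhood of `x`
    obtain ⟨U, hUo, hxU, ⟨h⟩⟩ := hch x
    let q : U ≃ₜ ℂ := h.trans Complex.equivRealProdCLM.symm.toHomeomorph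
    let k : ℂ → S := fun w => (q.symm w : S)
    have ko : IsOpenEmbedding k := hUo.isOpenEmbedding_subtypeVal.comp q.symm.isOpenEmbedding
    have kx : k (q ⟨x, hxU⟩) = x := by simp [k]
    let B := k '' closedBall (q ⟨x, hxU⟩) 1
    have Bc : IsCompact B := (isCompact_closedBall _ _).image ko.continuous
    have Bp : IsPreconnected B :=
      (convex_closedBall _ _).isPreconnected.image _ ko.continuous.continuousOn
    have Bn : B ∈ 𝓝 x := by
      rw [← kx]
      exact ko.isOpenMap.image_mem_nhds (closedBall_mem_nhds _ one_pos)
    obtain ⟨y, hyB, hyU⟩ := mem_closure_iff_nhds.1 hx B Bn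
    obtain ⟨n, hn⟩ := mem_iUnion.1 hyU
    obtain ⟨M, hM⟩ := (hlf B Bc).bddAbove
    let N := max n (M + 1)
    have hdis : Disjoint B (C N) := by
      by_contra hnd
      rw [Set.not_disjoint_iff] at hnd
      obtain ⟨w, hw1, hw2⟩ := hnd
      have h1 : N ≤ M := hM ⟨w, hw2, hw1⟩
      have h2 : M + 1 ≤ N := le_max_right _ _
      omega
    exact mem_iUnion.2 ⟨N, hsep N B Bp hdis ⟨y, hyB, hmono (le_max_left _ _) hn⟩
      (mem_of_mem_nhds Bn)⟩
  obtain ⟨Φ⟩ := brown D hDc (fun x => by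
      have hx : x ∈ ⋃ i, range (j i) := hU ▸ mem_univ x
      obtain ⟨n, hn⟩ := mem_iUnion.1 hx
      exact ⟨n, hOD n hn⟩) (fun L hL => by
      obtain ⟨n, hn⟩ := hL.elim_directed_cover (fun i => range (j i)) hO
        (by rw [hU]; exact subset_univ _) hmono.directed_le
      exact ⟨j n, hj n, hn⟩)
  exact ⟨Φ.trans Complex.equivRealProdCLM.toHomeomorph⟩
end
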